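/- Let (A,·) be an anti-flexible algebra with bimodule (M,l,r). A linear map T : M → A is a Rota–Baxter operator if and only if the linear map N_T on A ⊕ M defined by N_T(a,m) = (T(m), 0) is a Nijenhuis operator on the semidirect product anti-flexible algebra A ⊕ M. -/

import Mathlib

/-- The anti-flexible identity for a (bilinear) product. -/
def AntiFlexible {A : Type*} [AddCommGroup A] (mul : A → A → A) : Prop :=
  ∀ a b c : A, mul (mul a b) c - mul a (mul b c) = mul (mul c b) a - mul c (mul b a)

/-- Nijenhuis operator on `(A, mul)`. -/
def IsNijenhuis {A : Type*} [AddCommGroup A] (mul : A → A → A) (N : A → A) : Prop :=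
  ∀ a b : A, mul (N a) (N b) = N (mul (N a) b + mul a (N b) - N (mul a b))

/-- The bimodule equations for `(M, l, r)` over `(A, mul)`. -/
def IsBimodule {K A M : Type*} [Field K] [AddCommGroup A] [Module K A]
    [AddCommGroup M] [Module K M]
    (mul : A →ₗ[K] A →ₗ[K] A) (l r : A →ₗ[K] Module.End K M) : Prop :=
  (∀ a b : A, l (mul a b) - l a * l b = r a * r b - r (mul b a)) ∧
  (∀ a b : A, l a * r b - r b * l a = l b * r a - r a * l b)

/-- Rota–Baxter operator `T : M → A`. -/
def IsRotaBaxter {K A M : Type*} [Field K] [AddCommGroup A] [Module K A]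
    [AddCommGroup M] [Module K M]
    (mul : A →ₗ[K] A →ₗ[K] A) (l r : A →ₗ[K] Module.End K M) (T : M →ₗ[K] A) : Prop :=
  ∀ m n : M, mul (T m) (T n) = T (l (T m) n + r (T n) m)

/-- The semidirect product multiplication on `A ⊕ M`. -/
def mulSD {K A M : Type*} [Field K] [AddCommGroup A] [Module K A]
    [AddCommGroup M] [Module K M]
    (mul : A →ₗ[K] A →ₗ[K] A) (l r : A →ₗ[K] Module.End K M) :
    A × M → A × M → A × M :=
  fun p q => (mul p.1 q.1, l p.1 q.2 + r q.1 p.2)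

/-- `T` is a Rota–Baxter operator iff
`N_T(a,m) = (T m, 0)` is a Nijenhuis operator on the semidirect product `A ⊕ M`. -/
theorem rotaBaxter_iff_NT_nijenhuis {K A M : Type*} [Field K]
    [AddCommGroup A] [Module K A] [AddCommGroup M] [Module K M]
    (mul : A →ₗ[K] A →ₗ[K] A) (hA : AntiFlexible fun a b => mul a b)
    (l r : A →ₗ[K] Module.End K M) (hbim : IsBimodule mul l r)
    (T : M →ₗ[K] A) :
    IsRotaBaxter mul l r T ↔
      IsNijenhuis (mulSD mul l r) (fun p : A × M => ((T p.2, 0) : A × M)) := by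
  constructor
  · intro h p q
    simpa [mulSD] using h p.2 q.2
  · intro h m n
    simpa [mulSD] using congrArg Prod.fst (h (0, m) (0, n))
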